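/- For every positive integer d, the trace of singular moduli t(d) is positive if d ≡ 0 (mod 4) and negative if d ≡ 3 (mod 4). -/

import Mathlib

noncomputable section

/-- The weight `k` lattice Eisenstein sum `∑_{(c,d) ≠ (0,0)} 1/(cτ+d)^k`. -/
noncomputable def latticeG (k : ℕ) (τ : ℂ) : ℂ :=
  ∑' p : ℤ × ℤ, if p = 0 then 0 else 1 / ((p.1 : ℂ) * τ + (p.2 : ℂ)) ^ k

/-- The modular `j`-invariant `j = 1728 E₄³/(E₄³ - E₆²) = 1728 g₂³/(g₂³ - 27 g₃²)`. -/
noncomputable def jInv (τ : ℂ) : ℂ :=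
  1728 * (60 * latticeG 4 τ) ^ 3 /
    ((60 * latticeG 4 τ) ^ 3 - 27 * (140 * latticeG 6 τ) ^ 2)

/-- The value of the binary quadratic form `aX² + bXY + cY²` (encoded `(a, b, c)`) at `(x, y)`. -/
def formVal (f : ℤ × ℤ × ℤ) (x y : ℤ) : ℤ :=
  f.1 * x ^ 2 + f.2.1 * x * y + f.2.2 * y ^ 2

/-- `f` is a positive definite integral binary quadratic form of discriminant `-d`. -/
def IsForm (d : ℤ) (f : ℤ × ℤ × ℤ) : Prop :=
  0 < f.1 ∧ f.2.1 ^ 2 - 4 * f.1 * f.2.2 = -d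

/-- Two forms are `SL₂(ℤ)`-equivalent. -/
def FormRel (f f' : ℤ × ℤ × ℤ) : Prop :=
  ∃ g : Matrix.SpecialLinearGroup (Fin 2) ℤ,
    ∀ x y : ℤ,
      formVal f' x y =
        formVal f (g.1 0 0 * x + g.1 0 1 * y) (g.1 1 0 * x + g.1 1 1 * y)

/-- The set of `SL₂(ℤ)`-classes of positive definite forms of discriminant `-d`. -/
abbrev FormClass (d : ℤ) :=
  Quot (fun f f' : { f : ℤ × ℤ × ℤ // IsForm d f } => FormRel f.1 f'.1)

/-- The root `α_Q = (-b + i√d)/(2a)` in the upper half plane of `Q(X,1) = 0`. -/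
noncomputable def formRoot (f : ℤ × ℤ × ℤ) : ℂ :=
  (-(f.2.1 : ℂ) + Complex.I * ((Real.sqrt ((4 * f.1 * f.2.2 - f.2.1 ^ 2 : ℤ) : ℝ) : ℝ) : ℂ)) /
    (2 * (f.1 : ℂ))

/-- `w_Q`: the order of the stabilizer of the form `f` in `PSL₂(ℤ)`, i.e. half the order of
its stabilizer in `SL₂(ℤ)` (the stabilizer always contains `±1`). -/
noncomputable def formWt (f : ℤ × ℤ × ℤ) : ℕ :=
  Nat.card { g : Matrix.SpecialLinearGroup (Fin 2) ℤ //
    ∀ x y : ℤ,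
      formVal f x y =
        formVal f (g.1 0 0 * x + g.1 0 1 * y) (g.1 1 0 * x + g.1 1 1 * y) } / 2

/-- The trace of singular moduli `t(d) = ∑_{Q ∈ Q_d/Γ} (j(α_Q) - 744)/w_Q`, with the
conventions `t(0) = 2`, `t(-1) = -1` and `t(d) = 0` for `d < -1` or `d ≡ 1, 2 (mod 4)`. -/
noncomputable def traceSM (d : ℤ) : ℝ :=
  if d = 0 then 2
  else if d = -1 then -1
  else if d < -1 ∨ d % 4 = 1 ∨ d % 4 = 2 then 0
  else (∑ᶠ cl : FormClass d,
    (jInv (formRoot (Quot.out cl).1) - 744) / (formWt (Quot.out cl).1 : ℂ)).re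

end

section Analysis

open Complex ArithmeticFunction
open scoped ArithmeticFunction.sigma Nat

/-- The divisor power series `∑_{n ≥ 1} σ_k(n) q^n`. -/
noncomputable def sigmaSeries (k : ℕ) (q : ℂ) : ℂ := ∑' n : ℕ+, (σ k n : ℂ) * q ^ (n : ℕ)

lemma latticeG_eq_tsum_eisSummand (k : ℕ) (hk : k ≠ 0) (z : UpperHalfPlane) :
    latticeG k z = ∑' v : Fin 2 → ℤ, EisensteinSeries.eisSummand k v z := by
  rw [← (finTwoArrowEquiv ℤ).symm.tsum_eq, latticeG]
  refine tsum_congr fun p => ?_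
  split_ifs with hp
  · subst hp
    simp [EisensteinSeries.eisSummand, hk]
  · simp [EisensteinSeries.eisSummand]

lemma bernoulli'_six : bernoulli' 6 = 1 / 42 := by
  have h5 : bernoulli' 5 = 0 := by
    rw [bernoulli'_def]
    norm_num [Finset.sum_range_succ, Nat.choose]
  rw [bernoulli'_def]
  norm_num [Finset.sum_range_succ, Nat.choose, h5]

lemma riemannZeta_six : riemannZeta 6 = (Real.pi : ℂ) ^ 6 / 945 := by
  have h := riemannZeta_two_mul_nat (k := 3) (by norm_num)
  norm_num [bernoulli_eq_bernoulli'_of_ne_one, bernoulli'_six, Nat.factorial] at h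
  rw [h]
  ring

lemma latticeG_four (z : UpperHalfPlane) :
    latticeG 4 z =
      (Real.pi : ℂ) ^ 4 / 45 * (1 + 240 * sigmaSeries 3 (cexp (2 * Real.pi * I * z))) := by
  rw [latticeG_eq_tsum_eisSummand 4 (by norm_num)]
  have h := tsum_eisSummand_eq_tsum_sigma_mul_cexp_pow (k := 4) (by norm_num)
    (by decide) z
  have z4 : riemannZeta ((4 : ℕ) : ℂ) = (Real.pi : ℂ) ^ 4 / 90 := by
    exact_mod_cast riemannZeta_four
  have h4 : (-2 * (Real.pi : ℂ) * I) ^ 4 = 16 * (Real.pi : ℂ) ^ 4 := by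
    rw [mul_pow, I_pow_four]; ring
  rw [h, z4, h4, sigmaSeries]
  norm_num [Nat.factorial]
  ring

lemma latticeG_six (z : UpperHalfPlane) :
    latticeG 6 z =
      2 * (Real.pi : ℂ) ^ 6 / 945 * (1 - 504 * sigmaSeries 5 (cexp (2 * Real.pi * I * z))) := by
  rw [latticeG_eq_tsum_eisSummand 6 (by norm_num)]
  have h := tsum_eisSummand_eq_tsum_sigma_mul_cexp_pow (k := 6) (by norm_num)
    (by decide) z
  have z6 : riemannZeta ((6 : ℕ) : ℂ) = (Real.pi : ℂ) ^ 6 / 945 := by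
    exact_mod_cast riemannZeta_six
  have h6 : (-2 * (Real.pi : ℂ) * I) ^ 6 = -64 * (Real.pi : ℂ) ^ 6 := by
    rw [mul_pow, show I ^ 6 = I ^ 4 * I ^ 2 by ring, I_pow_four, I_sq]; ring
  rw [h, z6, h6, sigmaSeries]
  norm_num [Nat.factorial]
  ring

lemma jInv_eq_sigmaSeries (z : UpperHalfPlane) :
    jInv z = 1728 * (1 + 240 * sigmaSeries 3 (cexp (2 * Real.pi * I * z))) ^ 3 /
      ((1 + 240 * sigmaSeries 3 (cexp (2 * Real.pi * I * z))) ^ 3 -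
        (1 - 504 * sigmaSeries 5 (cexp (2 * Real.pi * I * z))) ^ 2) := by
  have hπ : (64 / 27 * (Real.pi : ℂ) ^ 12) ≠ 0 := by
    simp [Real.pi_ne_zero]
  rw [jInv, latticeG_four, latticeG_six]
  set a := 1 + 240 * sigmaSeries 3 (cexp (2 * Real.pi * I * z))
  set b := 1 - 504 * sigmaSeries 5 (cexp (2 * Real.pi * I * z))
  rw [show 1728 * (60 * ((Real.pi : ℂ) ^ 4 / 45 * a)) ^ 3 =
      (64 / 27 * (Real.pi : ℂ) ^ 12) * (1728 * a ^ 3) by ring,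
    show (60 * ((Real.pi : ℂ) ^ 4 / 45 * a)) ^ 3 -
      27 * (140 * (2 * (Real.pi : ℂ) ^ 6 / 945 * b)) ^ 2 =
      (64 / 27 * (Real.pi : ℂ) ^ 12) * (a ^ 3 - b ^ 2) by ring,
    mul_div_mul_left _ _ hπ]

lemma sigma_le_nine_pow {k : ℕ} (hk : k ≤ 5) (n : ℕ) : σ k n ≤ 9 ^ n := by
  rcases Nat.eq_zero_or_pos n with rfl | hn
  · simp
  have h3 : n ^ 3 ≤ 3 ^ n := by
    rcases lt_or_ge n 3 with h | h
    · interval_cases n <;> norm_num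
    · induction n, h using Nat.le_induction with
      | base => norm_num
      | succ m hm ih =>
        have := ih (by omega)
        rw [pow_succ 3 m]
        nlinarith [Nat.mul_le_mul hm hm, Nat.mul_le_mul (Nat.mul_le_mul hm hm) hm,
          Nat.mul_le_mul hm (Nat.mul_le_mul (le_refl m) (le_refl m))]
  calc σ k n ≤ n ^ (k + 1) := sigma_le_pow_succ k n
    _ ≤ n ^ 6 := Nat.pow_le_pow_right hn (by omega)
    _ = (n ^ 3) ^ 2 := by ring
    _ ≤ (3 ^ n) ^ 2 := Nat.pow_le_pow_left h3 2
    _ = 9 ^ n := by rw [← pow_mul, mul_comm, pow_mul]; norm_num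

lemma norm_sigmaSeries_sub_le {k : ℕ} (hk : k ≤ 5) {q : ℂ} (hq : ‖q‖ ≤ 1 / 200) :
    ‖sigmaSeries k q - (q + (1 + 2 ^ k) * q ^ 2)‖ ≤ 800 * ‖q‖ ^ 3 := by
  have hbd (n : ℕ) : ‖(σ k n : ℂ) * q ^ n‖ ≤ (9 * ‖q‖) ^ n := by
    rw [norm_mul, norm_pow, Complex.norm_natCast, mul_pow]
    gcongr
    exact_mod_cast sigma_le_nine_pow hk n
  have hr0 : 0 ≤ 9 * ‖q‖ := by positivity
  have hr1 : 9 * ‖q‖ < 1 := by linarith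
  have hs : Summable fun n : ℕ => (σ k n : ℂ) * q ^ n :=
    .of_norm_bounded (summable_geometric_of_lt_one hr0 hr1) hbd
  have hsplit := hs.sum_add_tsum_nat_add 3
  have h0 : sigmaSeries k q = ∑' n : ℕ, (σ k n : ℂ) * q ^ n := by
    rw [sigmaSeries, tsum_pnat_eq_tsum_succ (f := fun n : ℕ => (σ k n : ℂ) * q ^ n),
      hs.tsum_eq_zero_add]
    simp
  have h2 : σ k 2 = 1 + 2 ^ k := by
    rw [sigma_apply, Nat.Prime.divisors Nat.prime_two]; simp
  have hd : sigmaSeries k q - (q + (1 + 2 ^ k) * q ^ 2) =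
      ∑' n : ℕ, (σ k (n + 3) : ℂ) * q ^ (n + 3) := by
    rw [h0, ← hsplit]
    simp [Finset.sum_range_succ, h2]
  rw [hd]
  have hg := (hasSum_geometric_of_lt_one hr0 hr1).mul_left ((9 * ‖q‖) ^ 3)
  have hle := tsum_of_norm_bounded hg (f := fun n : ℕ => (σ k (n + 3) : ℂ) * q ^ (n + 3))
    (fun n => by
      refine (hbd (n + 3)).trans_eq ?_
      rw [pow_add, mul_comm])
  refine hle.trans ?_
  have : (1 - 9 * ‖q‖)⁻¹ ≤ 800 / 729 := by
    rw [inv_le_comm₀ (by linarith) (by norm_num)]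
    norm_num
    linarith
  calc (9 * ‖q‖) ^ 3 * (1 - 9 * ‖q‖)⁻¹ ≤ (9 * ‖q‖) ^ 3 * (800 / 729) := by gcongr
    _ = 800 * ‖q‖ ^ 3 := by ring

end Analysis

section JEstimate

open Complex

/-- With `s = (E₄ - 1) / q` and `t = (1 - E₆) / (504 q)`, expand `j - 744 - 1/q`. -/
lemma norm_jExpr_sub_le {q α β : ℂ} (hq0 : q ≠ 0) (hq : ‖q‖ ≤ 1 / 230) (hα : ‖α‖ ≤ 800)
    (hβ : ‖β‖ ≤ 800) :
    ‖1728 * (1 + 240 * (q + 9 * q ^ 2 + α * q ^ 3)) ^ 3 /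
        ((1 + 240 * (q + 9 * q ^ 2 + α * q ^ 3)) ^ 3 -
          (1 - 504 * (q + 33 * q ^ 2 + β * q ^ 3)) ^ 2) - 744 - 1 / q‖ ≤ 950000 * ‖q‖ := by
  set e : ℂ := 2160 + 240 * (q * α) with he
  set s : ℂ := 240 + q * e with hs
  set v : ℂ := 33 + q * β with hv
  set t : ℂ := 1 + q * v with ht
  set R : ℂ := 3 * e + 3 * s ^ 2 + q * s ^ 3 with hR
  set P : ℂ := (720 * α + 3 * (e * (s + 240)) + s ^ 3 + 1008 * β - 254016 * (v * (t + 1))) / 1728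
    with hP
  have hr0 := norm_nonneg q
  have hqα : ‖q * α‖ ≤ 1 / 230 * 800 := by rw [norm_mul]; gcongr
  have hqβ : ‖q * β‖ ≤ 1 / 230 * 800 := by rw [norm_mul]; gcongr
  have he' : ‖e‖ ≤ 2995 := by
    have : ‖240 * (q * α)‖ ≤ 240 * (1 / 230 * 800) := by
      rw [norm_mul, show ‖(240 : ℂ)‖ = 240 by norm_num]; gcongr
    refine (norm_add_le _ _).trans ?_
    norm_num [-norm_mul, -Complex.norm_mul] at this ⊢; linarith
  have hs' : ‖s‖ ≤ 253.1 := by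
    have : ‖q * e‖ ≤ 1 / 230 * 2995 := by rw [norm_mul]; gcongr
    refine (norm_add_le _ _).trans ?_
    norm_num; norm_num at this; linarith
  have hv' : ‖v‖ ≤ 36.5 := by
    refine (norm_add_le _ _).trans ?_
    norm_num; norm_num at hqβ; linarith
  have ht' : ‖t + 1‖ ≤ 2.16 := by
    have : ‖q * v‖ ≤ 1 / 230 * 36.5 := by rw [norm_mul]; gcongr
    rw [ht, show 1 + q * v + 1 = 2 + q * v by ring]
    refine (norm_add_le _ _).trans ?_
    norm_num; norm_num at this; linarith
  have hs3 : ‖s ^ 3‖ ≤ 253.1 ^ 3 := by rw [norm_pow]; gcongr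
  have hR' : ‖R‖ ≤ 272000 := by
    have h1 : ‖3 * e‖ ≤ 3 * 2995 := by rw [norm_mul]; norm_num; linarith
    have h2 : ‖3 * s ^ 2‖ ≤ 3 * 253.1 ^ 2 := by
      rw [norm_mul, norm_pow, show ‖(3 : ℂ)‖ = 3 by norm_num]; gcongr
    have h3 : ‖q * s ^ 3‖ ≤ 1 / 230 * 253.1 ^ 3 := by rw [norm_mul]; gcongr
    refine (norm_add₃_le).trans ?_
    norm_num at h1 h2 h3 ⊢; linarith
  have hP' : ‖P‖ ≤ 24400 := by
    have h1 : ‖720 * α‖ ≤ 720 * 800 := by rw [norm_mul]; norm_num; linarith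
    have h2 : ‖1008 * β‖ ≤ 1008 * 800 := by rw [norm_mul]; norm_num; linarith
    have h3 : ‖3 * (e * (s + 240))‖ ≤ 3 * (2995 * (253.1 + 240)) := by
      rw [norm_mul, norm_mul, show ‖(3 : ℂ)‖ = 3 by norm_num]
      gcongr
      refine (norm_add_le _ _).trans ?_
      norm_num at hs' ⊢; linarith
    have h4 : ‖254016 * (v * (t + 1))‖ ≤ 254016 * (36.5 * 2.16) := by
      rw [norm_mul, norm_mul, show ‖(254016 : ℂ)‖ = 254016 by norm_num]
      gcongr
    rw [hP, norm_div, show ‖(1728 : ℂ)‖ = 1728 by norm_num, div_le_iff₀ (by norm_num)]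
    refine (norm_sub_le _ _).trans ?_
    have h5 := norm_add_le (720 * α + 3 * (e * (s + 240)) + s ^ 3) (1008 * β)
    have h6 := norm_add₃_le (a := 720 * α) (b := 3 * (e * (s + 240))) (c := s ^ 3)
    norm_num at h1 h2 h3 h4 h5 h6 hs3 ⊢; linarith
  set D : ℂ := 1 - 24 * q + q ^ 2 * P with hD
  have hD' : 0.434 ≤ ‖D‖ := by
    have h1 : ‖24 * q‖ ≤ 24 * (1 / 230) := by rw [norm_mul]; norm_num; linarith
    have h2 : ‖q ^ 2 * P‖ ≤ (1 / 230) ^ 2 * 24400 := by rw [norm_mul, norm_pow]; gcongr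
    have h3 : (1 : ℂ) = D + 24 * q - q ^ 2 * P := by rw [hD]; ring
    have h4 := norm_sub_le (D + 24 * q) (q ^ 2 * P)
    rw [← h3, norm_one] at h4
    have h5 := norm_add_le D (24 * q)
    norm_num at h1 h2 h4 h5 ⊢; linarith
  have hD0 : D ≠ 0 := by
    intro h; rw [h, norm_zero] at hD'; norm_num at hD'
  have hnum : (1 + 240 * (q + 9 * q ^ 2 + α * q ^ 3)) ^ 3 = 1 + 720 * q + q ^ 2 * R := by
    rw [hR, hs, he]; ring
  have hden : (1 + 240 * (q + 9 * q ^ 2 + α * q ^ 3)) ^ 3 -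
      (1 - 504 * (q + 33 * q ^ 2 + β * q ^ 3)) ^ 2 = 1728 * (q * D) := by
    rw [hD, hP, ht, hv, hs, he]; ring
  rw [hden, hnum, mul_div_mul_left _ _ (by norm_num : (1728 : ℂ) ≠ 0)]
  have hfin : (1 + 720 * q + q ^ 2 * R) / (q * D) - 744 - 1 / q =
      q * (R + 17856 - P - 744 * (q * P)) / D := by
    field_simp
    rw [hD]; ring
  have hT : ‖R + 17856 - P - 744 * (q * P)‖ ≤ 950000 * 0.434 := by
    have h1 : ‖744 * (q * P)‖ ≤ 744 * (1 / 230 * 24400) := by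
      rw [norm_mul, norm_mul, show ‖(744 : ℂ)‖ = 744 by norm_num]; gcongr
    have h2 := norm_sub_le (R + 17856 - P) (744 * (q * P))
    have h3 := norm_sub_le (R + 17856) P
    have h4 := norm_add_le R 17856
    norm_num at h1 h2 h3 h4 ⊢; linarith
  rw [hfin, norm_div, norm_mul, div_le_iff₀ (by linarith)]
  calc ‖q‖ * _ ≤ ‖q‖ * (950000 * 0.434) := by gcongr
    _ ≤ ‖q‖ * (950000 * ‖D‖) := by gcongr
    _ = _ := by ring

lemma exists_sigmaSeries_eq {k : ℕ} (hk : k ≤ 5) {q : ℂ} (hq0 : q ≠ 0) (hq : ‖q‖ ≤ 1 / 200) :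
    ∃ α : ℂ, ‖α‖ ≤ 800 ∧ sigmaSeries k q = q + (1 + 2 ^ k) * q ^ 2 + α * q ^ 3 := by
  refine ⟨(sigmaSeries k q - (q + (1 + 2 ^ k) * q ^ 2)) / q ^ 3, ?_, ?_⟩
  · rw [norm_div, norm_pow, div_le_iff₀ (by positivity)]
    exact norm_sigmaSeries_sub_le hk hq
  · field_simp
    ring

lemma norm_jInv_sub_le (z : UpperHalfPlane) (hz : ‖cexp (2 * Real.pi * I * z)‖ ≤ 1 / 230) :
    ‖jInv z - 744 - 1 / cexp (2 * Real.pi * I * z)‖ ≤ 950000 * ‖cexp (2 * Real.pi * I * z)‖ := by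
  rw [jInv_eq_sigmaSeries]
  set q := cexp (2 * Real.pi * I * z)
  have hq0 : q ≠ 0 := Complex.exp_ne_zero _
  obtain ⟨α, hα, h3⟩ := exists_sigmaSeries_eq (k := 3) (by norm_num) hq0 (by linarith)
  obtain ⟨β, hβ, h5⟩ := exists_sigmaSeries_eq (k := 5) (by norm_num) hq0 (by linarith)
  have := norm_jExpr_sub_le hq0 hz hα hβ
  norm_num at h3 h5
  rwa [h3, h5]

lemma norm_cexp_two_pi_I_mul (z : ℂ) :
    ‖cexp (2 * Real.pi * I * z)‖ = Real.exp (-(2 * Real.pi * z.im)) := by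
  rw [Complex.norm_exp]
  simp

lemma exp_two_pi_mul_ge {y : ℝ} (hy : √3 / 2 ≤ y) : 230 ≤ Real.exp (2 * Real.pi * y) := by
  have h3 : (1.732 : ℝ) ≤ √3 := Real.le_sqrt_of_sq_le (by norm_num)
  have hπ := Real.pi_gt_d4
  have h1 : (5.441 : ℝ) ≤ 2 * Real.pi * y := by nlinarith
  have h2 : (230 : ℝ) ≤ Real.exp 5.441 := by
    have h4 : Real.exp 5.441 = Real.exp 1 ^ 5 * Real.exp 0.441 := by
      rw [← Real.exp_nat_mul, ← Real.exp_add]; norm_num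
    have h5 := Real.sum_le_exp_of_nonneg (x := 0.441) (by norm_num) 6
    norm_num [Finset.sum_range_succ, Nat.factorial] at h5
    have h6 := Real.exp_one_gt_d9
    have h7 : (2.7182818283 : ℝ) ^ 5 ≤ Real.exp 1 ^ 5 := by gcongr
    rw [h4]
    have h8 : (1.554 : ℝ) ≤ Real.exp 0.441 := by norm_num; linarith
    nlinarith
  exact h2.trans (Real.exp_le_exp.mpr h1)

/-- For `Im z ≥ √3 / 2`, `j(z) - 744` is `1/q` up to an error `O(|q|)`. -/
lemma norm_jInv_sub_exp_le {z : ℂ} (hz : √3 / 2 ≤ z.im) :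
    ‖jInv z - 744 - cexp (-(2 * Real.pi * I * z))‖ ≤
      950000 / Real.exp (2 * Real.pi * z.im) := by
  have hpos : 0 < z.im := lt_of_lt_of_le (by positivity) hz
  have hn := norm_cexp_two_pi_I_mul z
  rw [Real.exp_neg] at hn
  have := norm_jInv_sub_le ⟨z, hpos⟩ (by
    change ‖cexp (2 * Real.pi * I * z)‖ ≤ _
    rw [hn, ← one_div]
    exact one_div_le_one_div_of_le (by norm_num) (exp_two_pi_mul_ge hz))
  change ‖jInv z - 744 - 1 / cexp (2 * Real.pi * I * z)‖ ≤
    950000 * ‖cexp (2 * Real.pi * I * z)‖ at this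
  rwa [hn, one_div, ← Complex.exp_neg, ← div_eq_mul_inv] at this

lemma latticeG_four_I_ne_zero : latticeG 4 I ≠ 0 := by
  have h := latticeG_four UpperHalfPlane.I
  rw [UpperHalfPlane.coe_I] at h
  have hn := norm_cexp_two_pi_I_mul I
  set q := cexp (2 * Real.pi * I * I)
  have hq : ‖q‖ ≤ 1 / 400 := by
    rw [hn, Real.exp_neg, ← one_div]
    refine one_div_le_one_div_of_le (by norm_num) ?_
    have h6 := Real.exp_one_gt_d9
    have h7 : (2.7182818283 : ℝ) ^ 6 ≤ Real.exp 1 ^ 6 := by gcongr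
    rw [← Real.exp_nat_mul] at h7
    have h8 : Real.exp ((6 : ℕ) * 1) ≤ Real.exp (2 * Real.pi * I.im) := by
      rw [Real.exp_le_exp, I_im]
      norm_num
      linarith [Real.pi_gt_three]
    refine le_trans ?_ (h7.trans h8)
    norm_num
  have hr0 := norm_nonneg q
  have hs := norm_sigmaSeries_sub_le (k := 3) (by norm_num) (hq.trans (by norm_num))
  have h2 : ‖q + (1 + 2 ^ 3) * q ^ 2‖ ≤ 1 / 400 + 9 * (1 / 400) ^ 2 := by
    refine (norm_add_le _ _).trans ?_
    rw [norm_mul, norm_pow]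
    norm_num
    norm_num at hq
    nlinarith
  have h3 : 800 * ‖q‖ ^ 3 ≤ 800 * (1 / 400) ^ 3 := by gcongr
  have h4 : ‖sigmaSeries 3 q‖ ≤ 0.003 := by
    have := norm_sub_norm_le (sigmaSeries 3 q) (q + (1 + 2 ^ 3) * q ^ 2)
    norm_num at h2 h3 this hs ⊢
    linarith
  rw [h]
  refine mul_ne_zero (by simp [Real.pi_ne_zero]) fun h0 => ?_
  have h5 : (240 : ℂ) * sigmaSeries 3 q = -1 := by linear_combination h0
  have h6 := congrArg norm h5
  rw [norm_mul, norm_neg, norm_one] at h6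
  norm_num at h6 h4
  linarith

end JEstimate

section Modularity

open Complex

lemma latticeG_moebius (k : ℕ) {a b c e : ℤ} (h : a * e - b * c = 1) {τ : ℂ}
    (hw : (c : ℂ) * τ + e ≠ 0) :
    latticeG k ((a * τ + b) / (c * τ + e)) = (c * τ + e) ^ k * latticeG k τ := by
  let φ : ℤ × ℤ ≃ ℤ × ℤ :=
    { toFun := fun p => (p.1 * a + p.2 * c, p.1 * b + p.2 * e)
      invFun := fun p => (p.1 * e - p.2 * c, p.2 * a - p.1 * b)
      left_inv := fun p => Prod.ext (by linear_combination p.1 * h) (by linear_combination p.2 * h)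
      right_inv := fun p =>
        Prod.ext (by linear_combination p.1 * h) (by linear_combination p.2 * h) }
  have hφ (p : ℤ × ℤ) : φ p = 0 ↔ p = 0 := by
    have h0 : φ 0 = 0 := by simp [φ]
    rw [← φ.injective.eq_iff (a := p), h0]
  rw [latticeG, latticeG,
    ← φ.tsum_eq (fun p : ℤ × ℤ => if p = 0 then (0 : ℂ) else 1 / ((p.1 : ℂ) * τ + p.2) ^ k),
    ← tsum_mul_left]
  refine tsum_congr fun p => ?_
  simp only [hφ]
  split_ifs with hp
  · simp
  · have : (p.1 : ℂ) * ((a * τ + b) / (c * τ + e)) + p.2 =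
        (((φ p).1 : ℂ) * τ + ((φ p).2 : ℂ)) / (c * τ + e) := by
      simp only [φ, Equiv.coe_fn_mk]
      push_cast
      rw [eq_div_iff hw, add_mul, mul_assoc, div_mul_cancel₀ _ hw]
      ring
    rw [this, div_pow, one_div_div, div_eq_mul_one_div]

lemma jInv_moebius {a b c e : ℤ} (h : a * e - b * c = 1) {τ : ℂ} (hw : (c : ℂ) * τ + e ≠ 0) :
    jInv ((a * τ + b) / (c * τ + e)) = jInv τ := by
  rw [jInv, jInv, latticeG_moebius 4 h hw, latticeG_moebius 6 h hw]
  set w := (c : ℂ) * τ + e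
  rw [← mul_div_mul_left (1728 * (60 * latticeG 4 τ) ^ 3) _ (pow_ne_zero 12 hw)]
  congr 1 <;> ring

lemma im_moebius_pos {a b c e : ℤ} (h : a * e - b * c = 1) {τ : ℂ} (hτ : 0 < τ.im)
    (hw : (c : ℂ) * τ + e ≠ 0) : 0 < ((a * τ + b) / (c * τ + e)).im := by
  have hR : (a * e - b * c : ℝ) = 1 := by exact_mod_cast h
  have hn : 0 < normSq ((c : ℂ) * τ + e) := normSq_pos.mpr hw
  have : ((a * τ + b) / (c * τ + e)).im = τ.im / normSq ((c : ℂ) * τ + e) := by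
    rw [div_im, div_sub_div_same]
    congr 1
    simp
    linear_combination τ.im * hR
  rw [this]
  positivity

lemma moebius_denom_ne_zero {a b c e : ℤ} (h : a * e - b * c = 1) {τ : ℂ} (hτ : 0 < τ.im) :
    (c : ℂ) * τ + e ≠ 0 := by
  intro h0
  have him := congrArg im h0
  have hre := congrArg re h0
  simp at him hre
  rcases him with hc | h'
  · subst hc
    simp at hre
    subst hre
    simp at h
  · exact hτ.ne' h'

lemma jInv_I : jInv I = 1728 := by
  have h := latticeG_moebius 6 (a := 0) (b := -1) (c := 1) (e := 0) (by norm_num) (τ := I)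
    (by simp)
  have hI6 : I ^ 6 = -1 := by rw [show I ^ 6 = I ^ 4 * I ^ 2 by ring, I_pow_four, I_sq]; ring
  have h6 : latticeG 6 I = 0 := by
    simp [neg_div, hI6] at h
    linear_combination h / 2
  have h4 := latticeG_four_I_ne_zero
  rw [jInv, h6]
  field_simp
  ring

lemma jInv_of_sq_add_self_add_one {ρ : ℂ} (hρ : ρ ^ 2 + ρ + 1 = 0) : jInv ρ = 0 := by
  have hw : ρ + 1 ≠ 0 := fun h => by
    rw [eq_neg_of_add_eq_zero_left h] at hρ
    norm_num at hρ
  have h := latticeG_moebius 4 (a := 0) (b := -1) (c := 1) (e := 1) (by norm_num) (τ := ρ)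
    (by simpa using hw)
  have hfix : -1 / (ρ + 1) = ρ := by
    rw [div_eq_iff hw]; linear_combination -hρ
  have h4 : (ρ + 1) ^ 4 = -1 - ρ := by
    linear_combination (ρ ^ 2 + 3 * ρ + 2) * hρ
  simp only [Int.cast_zero, zero_mul, zero_add, Int.cast_neg, Int.cast_one, one_mul, hfix, h4] at h
  have h0 : (ρ + 2) * latticeG 4 ρ = 0 := by linear_combination h
  have h2 : ρ + 2 ≠ 0 := fun h => by
    rw [eq_neg_of_add_eq_zero_left h] at hρ
    norm_num at hρ
  rw [jInv, (mul_eq_zero.mp h0).resolve_left h2]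
  simp

end Modularity

section Forms

open Complex

lemma FormRel.refl (f : ℤ × ℤ × ℤ) : FormRel f f := ⟨1, fun x y => by simp⟩

lemma formVal_inv {f f' : ℤ × ℤ × ℤ} {g : Matrix.SpecialLinearGroup (Fin 2) ℤ}
    (hg : ∀ x y : ℤ, formVal f' x y =
      formVal f (g.1 0 0 * x + g.1 0 1 * y) (g.1 1 0 * x + g.1 1 1 * y)) (x y : ℤ) :
    formVal f x y =
      formVal f' (g⁻¹.1 0 0 * x + g⁻¹.1 0 1 * y) (g⁻¹.1 1 0 * x + g⁻¹.1 1 1 * y) := by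
  have hd := g.det_coe
  rw [Matrix.det_fin_two] at hd
  rw [hg, Matrix.SpecialLinearGroup.SL2_inv_expl]
  simp only [Matrix.cons_val', Matrix.cons_val_zero, Matrix.cons_val_one,
    Matrix.cons_val_fin_one]
  congr 1
  · linear_combination -x * hd
  · linear_combination -y * hd

lemma FormRel.symm {f f' : ℤ × ℤ × ℤ} (h : FormRel f f') : FormRel f' f :=
  let ⟨g, hg⟩ := h
  ⟨g⁻¹, formVal_inv hg⟩

lemma FormRel.trans {f f' f'' : ℤ × ℤ × ℤ} (h : FormRel f f') (h' : FormRel f' f'') :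
    FormRel f f'' := by
  obtain ⟨g, hg⟩ := h
  obtain ⟨g', hg'⟩ := h'
  refine ⟨g * g', fun x y => ?_⟩
  rw [hg', hg]
  simp only [Matrix.SpecialLinearGroup.coe_mul, Matrix.mul_apply, Fin.sum_univ_two]
  congr 1 <;> ring

lemma formClass_mk_eq_iff {d : ℤ} (f f' : { f : ℤ × ℤ × ℤ // IsForm d f }) :
    (Quot.mk _ f : FormClass d) = Quot.mk _ f' ↔ FormRel f.1 f'.1 :=
  Equivalence.quot_mk_eq_iff
    (r := fun f f' : { f : ℤ × ℤ × ℤ // IsForm d f } => FormRel f.1 f'.1)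
    ⟨fun f => .refl f.1, fun h => h.symm, fun h h' => h.trans h'⟩ f f'

lemma formRel_translate (a b c k : ℤ) :
    FormRel (a, b, c) (a, b + 2 * a * k, a * k ^ 2 + b * k + c) :=
  ⟨⟨!![1, k; 0, 1], by simp [Matrix.det_fin_two]⟩, fun x y => by simp [formVal]; ring⟩

lemma formRel_swap (a b c : ℤ) : FormRel (a, b, c) (c, -b, a) :=
  ⟨⟨!![0, -1; 1, 0], by simp [Matrix.det_fin_two]⟩, fun x y => by simp [formVal]; ring⟩

/-- Every positive definite form is equivalent to a (weakly) reduced one. -/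
lemma exists_reduced {d : ℤ} (hd : 0 < d) (f : ℤ × ℤ × ℤ) (hf : IsForm d f) :
    ∃ f' : ℤ × ℤ × ℤ, IsForm d f' ∧ FormRel f f' ∧ |f'.2.1| ≤ f'.1 ∧ f'.1 ≤ f'.2.2 := by
  induction hn : f.1.toNat using Nat.strong_induction_on generalizing f with
  | _ n ih =>
    obtain ⟨a, b, c⟩ := f
    obtain ⟨ha, hdisc⟩ := hf
    simp only at ha hdisc hn
    set k := -((b + a) / (2 * a)) with hk
    have hmod : b + 2 * a * k = (b + a) % (2 * a) - a := by
      rw [Int.emod_def, hk]; ring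
    have h1 := Int.emod_nonneg (b + a) (by omega : 2 * a ≠ 0)
    have h2 := Int.emod_lt_of_pos (b + a) (by omega : 0 < 2 * a)
    have hrel := formRel_translate a b c k
    set b' := b + 2 * a * k
    set c' := a * k ^ 2 + b * k + c
    have hdisc' : b' ^ 2 - 4 * a * c' = -d := by
      rw [← hdisc]; simp only [b', c']; ring
    have hb' : |b'| ≤ a := abs_le.mpr ⟨by omega, by omega⟩
    rcases le_or_gt a c' with hac | hac
    · exact ⟨(a, b', c'), ⟨ha, hdisc'⟩, hrel, hb', hac⟩
    · have hc' : 0 < c' := by nlinarith [sq_nonneg b']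
      obtain ⟨f', hf', hr, hr'⟩ := ih c'.toNat (by omega) (c', -b', a)
        ⟨hc', by simp only; linear_combination hdisc'⟩ rfl
      exact ⟨f', hf', (hrel.trans (formRel_swap a b' c')).trans hr, hr'⟩

lemma IsForm.four_mul_sub {d : ℤ} {f : ℤ × ℤ × ℤ} (hf : IsForm d f) :
    4 * f.1 * f.2.2 - f.2.1 ^ 2 = d := by
  linarith [hf.2]

lemma IsForm.formRoot_eq {d : ℤ} {f : ℤ × ℤ × ℤ} (hf : IsForm d f) :
    formRoot f = (-(f.2.1 : ℂ) + I * (√(d : ℝ) : ℝ)) / (2 * f.1) := by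
  rw [formRoot, hf.four_mul_sub]

lemma IsForm.formRoot_im {d : ℤ} {f : ℤ × ℤ × ℤ} (hf : IsForm d f) :
    (formRoot f).im = √(d : ℝ) / (2 * f.1) := by
  rw [hf.formRoot_eq, show (2 * (f.1 : ℂ)) = ((2 * f.1 : ℝ) : ℂ) by push_cast; rfl, div_ofReal_im]
  simp

lemma IsForm.formRoot_im_pos {d : ℤ} (hd : 0 < d) {f : ℤ × ℤ × ℤ} (hf : IsForm d f) :
    0 < (formRoot f).im := by
  have h1 : (0 : ℝ) < d := by exact_mod_cast hd
  have h2 : (0 : ℝ) < f.1 := by exact_mod_cast hf.1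
  rw [hf.formRoot_im]
  positivity

lemma ofReal_sqrt_intCast_sq {d : ℤ} (hd : 0 < d) : ((√(d : ℝ) : ℝ) : ℂ) ^ 2 = d := by
  have h1 : (0 : ℝ) ≤ d := by exact_mod_cast hd.le
  rw [← ofReal_pow, Real.sq_sqrt h1]
  simp

lemma IsForm.formRoot_isRoot {d : ℤ} (hd : 0 < d) {f : ℤ × ℤ × ℤ} (hf : IsForm d f) :
    (f.1 : ℂ) * formRoot f ^ 2 + f.2.1 * formRoot f + f.2.2 = 0 := by
  have ha : (f.1 : ℂ) ≠ 0 := by exact_mod_cast hf.1.ne'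
  have hs := ofReal_sqrt_intCast_sq hd
  have hdisc : (4 * f.1 * f.2.2 - f.2.1 ^ 2 : ℂ) = d := by exact_mod_cast hf.four_mul_sub
  rw [hf.formRoot_eq]
  field_simp
  ring_nf
  rw [I_sq, hs, ← hdisc]
  ring

lemma IsForm.eq_formRoot {d : ℤ} (hd : 0 < d) {f : ℤ × ℤ × ℤ} (hf : IsForm d f) {z : ℂ}
    (hz : 0 < z.im) (h : (f.1 : ℂ) * z ^ 2 + f.2.1 * z + f.2.2 = 0) : z = formRoot f := by
  have ha : (f.1 : ℂ) ≠ 0 := by exact_mod_cast hf.1.ne'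
  have haR : (0 : ℝ) < f.1 := by exact_mod_cast hf.1
  have hs := ofReal_sqrt_intCast_sq hd
  have hdisc : (4 * f.1 * f.2.2 - f.2.1 ^ 2 : ℂ) = d := by exact_mod_cast hf.four_mul_sub
  have hsq : (2 * f.1 * z + f.2.1) ^ 2 = (I * (√(d : ℝ) : ℝ)) ^ 2 := by
    rw [mul_pow, I_sq, hs, ← hdisc]
    linear_combination 4 * (f.1 : ℂ) * h
  rcases sq_eq_sq_iff_eq_or_eq_neg.mp hsq with h1 | h1
  · rw [hf.formRoot_eq, eq_div_iff (by simpa using ha)]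
    linear_combination h1
  · have him := congrArg im h1
    simp at him
    nlinarith [Real.sqrt_nonneg (d : ℝ), mul_pos haR hz]

lemma FormRel.jInv_formRoot_eq {d : ℤ} (hd : 0 < d) {f f' : ℤ × ℤ × ℤ} (hf : IsForm d f)
    (hf' : IsForm d f') (h : FormRel f f') : jInv (formRoot f) = jInv (formRoot f') := by
  obtain ⟨g, hg⟩ := h
  have hdet := g.det_coe
  rw [Matrix.det_fin_two] at hdet
  have h10 := hg 1 0
  have h01 := hg 0 1
  have h11 := hg 1 1
  simp only [formVal] at h10 h01 h11
  set a := g.1 0 0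
  set b := g.1 0 1
  set c := g.1 1 0
  set e := g.1 1 1
  have hA : f'.1 = f.1 * a ^ 2 + f.2.1 * a * c + f.2.2 * c ^ 2 := by linear_combination h10
  have hC : f'.2.2 = f.1 * b ^ 2 + f.2.1 * b * e + f.2.2 * e ^ 2 := by linear_combination h01
  have hB : f'.2.1 = 2 * f.1 * a * b + f.2.1 * (a * e + b * c) + 2 * f.2.2 * c * e := by
    linear_combination h11 - h10 - h01
  have hτ := hf'.formRoot_im_pos hd
  have hroot := hf'.formRoot_isRoot hd
  have hw := moebius_denom_ne_zero hdet hτ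
  rw [← jInv_moebius hdet hw]
  congr 1
  symm
  refine hf.eq_formRoot hd (im_moebius_pos hdet hτ hw) ?_
  rw [hA, hB, hC] at hroot
  push_cast at hroot
  set τ := formRoot f'
  set w := (c : ℂ) * τ + e with hwdef
  have : (f.1 : ℂ) * ((a * τ + b) / w) ^ 2 + f.2.1 * ((a * τ + b) / w) + f.2.2 =
      (f.1 * (a * τ + b) ^ 2 + f.2.1 * (a * τ + b) * w + f.2.2 * w ^ 2) / w ^ 2 := by
    field_simp
  rw [this, div_eq_zero_iff]
  left
  rw [hwdef]
  linear_combination hroot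

lemma FormRel.formWt_eq {f f' : ℤ × ℤ × ℤ} (h : FormRel f f') : formWt f = formWt f' := by
  obtain ⟨h, hh⟩ := h
  have hinv := formVal_inv hh
  have key (f f' : ℤ × ℤ × ℤ) (h : Matrix.SpecialLinearGroup (Fin 2) ℤ)
      (h1 : ∀ x y, formVal f' x y =
        formVal f (h.1 0 0 * x + h.1 0 1 * y) (h.1 1 0 * x + h.1 1 1 * y))
      (h2 : ∀ x y, formVal f x y =
        formVal f' (h⁻¹.1 0 0 * x + h⁻¹.1 0 1 * y) (h⁻¹.1 1 0 * x + h⁻¹.1 1 1 * y))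
      (g : Matrix.SpecialLinearGroup (Fin 2) ℤ)
      (hg : ∀ x y, formVal f x y =
        formVal f (g.1 0 0 * x + g.1 0 1 * y) (g.1 1 0 * x + g.1 1 1 * y)) (x y : ℤ) :
      formVal f' x y = formVal f' ((h⁻¹ * g * h).1 0 0 * x + (h⁻¹ * g * h).1 0 1 * y)
        ((h⁻¹ * g * h).1 1 0 * x + (h⁻¹ * g * h).1 1 1 * y) := by
    rw [h1, hg, h2]
    simp only [Matrix.SpecialLinearGroup.coe_mul, Matrix.mul_apply, Fin.sum_univ_two]
    congr 1 <;> ring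
  unfold formWt
  congr 1
  refine Nat.card_congr
    { toFun := fun g => ⟨h⁻¹ * g.1 * h, key f f' h hh hinv g.1 g.2⟩
      invFun := fun g => ⟨h * g.1 * h⁻¹, by
        simpa using key f' f h⁻¹ hinv (by simpa using hh) g.1 g.2⟩
      left_inv := fun g => Subtype.ext (by simp [mul_assoc])
      right_inv := fun g => Subtype.ext (by simp [mul_assoc]) }

end Forms

section Principal

open Complex

/-- The principal form of discriminant `-d`, for `d ≡ 0, 3 (mod 4)`. -/
def principalForm (d : ℤ) : ℤ × ℤ × ℤ := (1, d % 2, (d + d % 2) / 4)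

lemma isForm_principalForm {d : ℤ} (hm : d % 4 = 0 ∨ d % 4 = 3) : IsForm d (principalForm d) := by
  refine ⟨by simp [principalForm], ?_⟩
  simp only [principalForm]
  rcases Int.emod_two_eq_zero_or_one d with h | h <;> rw [h] <;> omega

lemma formRel_principalForm {d : ℤ} {f : ℤ × ℤ × ℤ} (hf : IsForm d f) (ha : f.1 = 1) (hb : |f.2.1| ≤ 1) : FormRel f (principalForm d) := by
  obtain ⟨a, b, c⟩ := f
  obtain ⟨-, hd⟩ := hf
  simp only at ha hb hd
  subst ha
  obtain ⟨h1, h2⟩ := abs_le.mp hb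
  have hb3 : b = -1 ∨ b = 0 ∨ b = 1 := by omega
  rcases hb3 with rfl | rfl | rfl
  · have h := formRel_translate 1 (-1) c 1
    have hp : principalForm d = (1, -1 + 2 * 1 * 1, 1 * 1 ^ 2 + -1 * 1 + c) := by
      have hd' : d = 4 * c - 1 := by linarith
      simp only [principalForm, Prod.mk.injEq]
      exact ⟨trivial, by omega, by omega⟩
    rwa [hp]
  · have hp : principalForm d = (1, 0, c) := by
      have hd' : d = 4 * c := by linarith
      simp only [principalForm, Prod.mk.injEq]
      exact ⟨trivial, by omega, by omega⟩
    rw [hp]; exact .refl _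
  · have hp : principalForm d = (1, 1, c) := by
      have hd' : d = 4 * c - 1 := by linarith
      simp only [principalForm, Prod.mk.injEq]
      exact ⟨trivial, by omega, by omega⟩
    rw [hp]; exact .refl _

/-- Completing the square. -/
lemma IsForm.sq_add_mul_sq {d : ℤ} {f : ℤ × ℤ × ℤ} (hf : IsForm d f) (x y : ℤ) :
    (2 * f.1 * x + f.2.1 * y) ^ 2 + d * y ^ 2 = 4 * f.1 * formVal f x y := by
  rw [formVal, ← hf.four_mul_sub]; ring

lemma formWt_principalForm {d : ℤ} (hd : 4 < d) (hm : d % 4 = 0 ∨ d % 4 = 3) :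
    formWt (principalForm d) = 1 := by
  have hp := isForm_principalForm hm
  have hset : { g : Matrix.SpecialLinearGroup (Fin 2) ℤ | ∀ x y : ℤ,
      formVal (principalForm d) x y = formVal (principalForm d)
        (g.1 0 0 * x + g.1 0 1 * y) (g.1 1 0 * x + g.1 1 1 * y) } = {1, -1} := by
    ext g
    simp only [Set.mem_ofPred_eq, Set.mem_insert_iff, Set.mem_singleton_iff]
    constructor
    · intro hg
      have hdet := g.det_coe
      rw [Matrix.det_fin_two] at hdet
      have h10 := hg 1 0
      have h01 := hg 0 1
      have h11 := hg 1 1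
      have hsq := hp.sq_add_mul_sq (g.1 0 0) (g.1 1 0)
      simp only [mul_one, mul_zero, add_zero, zero_add] at h10 h01 h11
      rw [← h10] at hsq
      simp only [formVal, principalForm] at h10 h01 h11 hsq
      set ε := d % 2
      set m := (d + ε) / 4
      have hc : g.1 1 0 = 0 := by
        by_contra hne
        have h1 : 0 < g.1 1 0 ^ 2 := by positivity
        nlinarith [sq_nonneg (2 * 1 * g.1 0 0 + ε * g.1 1 0)]
      rw [hc] at hdet h10 h11
      have he : g.1 0 0 * g.1 1 1 = 1 := by linarith
      have hb : 2 * (g.1 0 0 * g.1 0 1) = 0 := by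
        linear_combination -h11 + h10 + h01 - ε * he
      have hb0 : g.1 0 1 = 0 := by
        rcases mul_eq_zero.mp (by omega : g.1 0 0 * g.1 0 1 = 0) with h | h
        · rw [h] at he; simp at he
        · exact h
      rcases Int.mul_eq_one_iff_eq_one_or_neg_one.mp he with ⟨h0, h1⟩ | ⟨h0, h1⟩
      · left
        ext i j
        fin_cases i <;> fin_cases j <;> simp [h0, h1, hc, hb0]
      · right
        ext i j
        fin_cases i <;> fin_cases j <;> simp [h0, h1, hc, hb0]
    · rintro (rfl | rfl) x y
      · simp
      · simp [formVal]
  have hne : (1 : Matrix.SpecialLinearGroup (Fin 2) ℤ) ≠ -1 := by decide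
  have hcard := congrArg Set.ncard hset
  rw [Set.ncard_pair hne, ← Nat.card_coe_set_eq] at hcard
  rw [formWt]
  exact (congrArg (· / 2) hcard : _)

lemma formWt_principalForm_pos {d : ℤ} (hd : d = 3 ∨ d = 4) : 0 < formWt (principalForm d) := by
  have hp : IsForm d (principalForm d) := isForm_principalForm (by omega)
  have hm : formVal (principalForm d) 1 0 = 1 ∧ formVal (principalForm d) 0 1 = 1 := by
    rcases hd with rfl | rfl <;> simp [formVal, principalForm]
  have hsmall (x y : ℤ) (h : formVal (principalForm d) x y = 1) :
      (-2 ≤ x ∧ x ≤ 2) ∧ (-2 ≤ y ∧ y ≤ 2) := by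
    rcases hd with rfl | rfl <;> simp [formVal, principalForm] at h <;>
      exact ⟨⟨by nlinarith [sq_nonneg (x + 2 * y)], by nlinarith [sq_nonneg (x + 2 * y)]⟩,
        ⟨by nlinarith [sq_nonneg (2 * x + y)], by nlinarith [sq_nonneg (2 * x + y)]⟩⟩
  let S := { g : Matrix.SpecialLinearGroup (Fin 2) ℤ // ∀ x y : ℤ,
      formVal (principalForm d) x y = formVal (principalForm d)
        (g.1 0 0 * x + g.1 0 1 * y) (g.1 1 0 * x + g.1 1 1 * y) }
  have : Finite S := by
    let F : S → (Finset.Icc (-2 : ℤ) 2 × Finset.Icc (-2 : ℤ) 2) ×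
        (Finset.Icc (-2 : ℤ) 2 × Finset.Icc (-2 : ℤ) 2) := fun g =>
      have h1 := hsmall (g.1.1 0 0) (g.1.1 1 0) (by
        have := g.2 1 0
        rw [hm.1] at this
        simpa using this.symm)
      have h2 := hsmall (g.1.1 0 1) (g.1.1 1 1) (by
        have := g.2 0 1
        rw [hm.2] at this
        simpa using this.symm)
      ((⟨g.1.1 0 0, Finset.mem_Icc.mpr h1.1⟩, ⟨g.1.1 1 0, Finset.mem_Icc.mpr h1.2⟩),
        (⟨g.1.1 0 1, Finset.mem_Icc.mpr h2.1⟩, ⟨g.1.1 1 1, Finset.mem_Icc.mpr h2.2⟩))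
    refine Finite.of_injective F fun g g' h => ?_
    simp only [F, Prod.mk.injEq, Subtype.mk.injEq] at h
    ext i j
    fin_cases i <;> fin_cases j <;> simp [h]
  have : Nontrivial S :=
    ⟨⟨1, fun x y => by simp⟩, ⟨-1, fun x y => by simp [formVal]⟩, fun h =>
      (by decide : (1 : Matrix.SpecialLinearGroup (Fin 2) ℤ) ≠ -1) (congrArg Subtype.val h)⟩
  exact Nat.div_pos (Finite.one_lt_card (α := S)) (by norm_num)

end Principal

section Trace

open Complex

/-- The contribution of a form to the trace of singular moduli. -/
noncomputable def traceTerm (f : ℤ × ℤ × ℤ) : ℂ := (jInv (formRoot f) - 744) / (formWt f : ℂ)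

lemma FormRel.traceTerm_eq {d : ℤ} (hd : 0 < d) {f f' : ℤ × ℤ × ℤ} (hf : IsForm d f)
    (hf' : IsForm d f') (h : FormRel f f') : traceTerm f = traceTerm f' := by
  rw [traceTerm, traceTerm, h.jInv_formRoot_eq hd hf hf', h.formWt_eq]

lemma three_mul_sq_le {d : ℤ} {f : ℤ × ℤ × ℤ} (hf : IsForm d f) (hb : |f.2.1| ≤ f.1)
    (hc : f.1 ≤ f.2.2) : 3 * f.1 ^ 2 ≤ d := by
  have h1 := hf.four_mul_sub
  have h2 : f.2.1 ^ 2 ≤ f.1 ^ 2 := sq_le_sq' (abs_le.mp hb).1 (abs_le.mp hb).2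
  nlinarith [hf.1]

lemma sqrt_three_le_im {d : ℤ} {f : ℤ × ℤ × ℤ} (hf : IsForm d f) (h : 3 * f.1 ^ 2 ≤ d) :
    √3 / 2 ≤ (formRoot f).im := by
  have ha : (0 : ℝ) < f.1 := by exact_mod_cast hf.1
  rw [hf.formRoot_im, div_le_div_iff₀ (by norm_num) (by positivity)]
  have h1 : √3 * f.1 ≤ √(d : ℝ) := by
    refine Real.le_sqrt_of_sq_le ?_
    rw [mul_pow, Real.sq_sqrt (by norm_num)]
    exact_mod_cast h
  linarith

/-- The non-principal forms contribute little. -/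
lemma norm_traceTerm_le {d : ℤ} {f : ℤ × ℤ × ℤ} (hf : IsForm d f)
    (h : 3 * f.1 ^ 2 ≤ d) (ha : 2 ≤ f.1) :
    ‖traceTerm f‖ ≤ Real.exp (Real.pi * √(d : ℝ) / 2) + 4131 := by
  have him := sqrt_three_le_im hf h
  have hj := norm_jInv_sub_exp_le him
  have hexp := exp_two_pi_mul_ge him
  have hE : ‖cexp (-(2 * Real.pi * I * formRoot f))‖ ≤ Real.exp (Real.pi * √(d : ℝ) / 2) := by
    rw [Complex.exp_neg, norm_inv, norm_cexp_two_pi_I_mul, Real.exp_neg, inv_inv,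
      Real.exp_le_exp, hf.formRoot_im]
    have haR : (2 : ℝ) ≤ f.1 := by exact_mod_cast ha
    rw [show 2 * Real.pi * (√(d : ℝ) / (2 * f.1)) = Real.pi * √(d : ℝ) / f.1 by
      field_simp]
    gcongr
  have hq : 950000 / Real.exp (2 * Real.pi * (formRoot f).im) ≤ 4131 := by
    rw [div_le_iff₀ (by positivity)]
    linarith
  have hn : ‖jInv (formRoot f) - 744‖ ≤ Real.exp (Real.pi * √(d : ℝ) / 2) + 4131 := by
    have := norm_add_le (jInv (formRoot f) - 744 - cexp (-(2 * Real.pi * I * formRoot f)))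
      (cexp (-(2 * Real.pi * I * formRoot f)))
    rw [sub_add_cancel] at this
    linarith
  rw [traceTerm, norm_div, Complex.norm_natCast]
  rcases Nat.eq_zero_or_pos (formWt f) with hw | hw
  · rw [hw, Nat.cast_zero, div_zero]; positivity
  · exact (div_le_self (norm_nonneg _) (by exact_mod_cast hw)).trans hn

/-- The principal form contributes `±exp (π √d)` up to a small error. -/
lemma norm_traceTerm_principalForm_sub_le {d : ℤ} (hd : 4 < d) (hm : d % 4 = 0 ∨ d % 4 = 3) :
    ‖traceTerm (principalForm d) - (-1) ^ (d % 2) * (Real.exp (Real.pi * √(d : ℝ)) : ℝ)‖ ≤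
      950000 / Real.exp (Real.pi * √(d : ℝ)) := by
  have hp := isForm_principalForm hm
  have hj := norm_jInv_sub_exp_le (sqrt_three_le_im hp (by simp only [principalForm]; omega))
  rw [traceTerm, formWt_principalForm hd hm, Nat.cast_one, div_one]
  have h1 : cexp (-(2 * Real.pi * I * formRoot (principalForm d))) =
      (-1) ^ (d % 2) * (Real.exp (Real.pi * √(d : ℝ)) : ℝ) := by
    rw [hp.formRoot_eq]
    simp only [principalForm]
    rw [← exp_pi_mul_I, ← Complex.exp_int_mul, ofReal_exp, ← Complex.exp_add]
    congr 1
    push_cast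
    linear_combination -(Real.pi : ℂ) * (√(d : ℝ) : ℝ) * I_sq
  have h2 : 2 * Real.pi * (formRoot (principalForm d)).im = Real.pi * √(d : ℝ) := by
    rw [hp.formRoot_im]
    simp only [principalForm]
    push_cast
    ring
  rwa [h1, h2] at hj

/-- Up to the principal form, the trace is a sum over few reduced forms. -/
lemma exists_finsum_eq {d : ℤ} (hd : 0 < d) (hm : d % 4 = 0 ∨ d % 4 = 3) :
    ∃ (N : ℕ) (r : ℂ), 3 * (N : ℤ) ≤ 2 * d ∧ (d < 12 → N = 0) ∧
      ‖r‖ ≤ N * (Real.exp (Real.pi * √(d : ℝ) / 2) + 4131) ∧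
      ∑ᶠ cl : FormClass d, traceTerm (Quot.out cl).1 = traceTerm (principalForm d) + r := by
  classical
  have hp := isForm_principalForm hm
  choose red hred hrel hb hc using
    fun cl : FormClass d => exists_reduced hd (Quot.out cl).1 (Quot.out cl).2
  have h3 (cl : FormClass d) := three_mul_sq_le (hred cl) (hb cl) (hc cl)
  let φ : FormClass d → ℤ × ℤ := fun cl => ((red cl).1, (red cl).2.1)
  have hmk (cl cl' : FormClass d) (h : FormRel (Quot.out cl).1 (Quot.out cl').1) : cl = cl' := by
    rw [← Quot.out_eq cl, ← Quot.out_eq cl']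
    exact (formClass_mk_eq_iff _ _).mpr h
  have hφ : Function.Injective φ := by
    intro cl cl' h
    simp only [φ, Prod.mk.injEq] at h
    have h22 : (red cl).2.2 = (red cl').2.2 := by
      have e1 := (hred cl).four_mul_sub
      have e2 := (hred cl').four_mul_sub
      rw [h.1, h.2, ← e2] at e1
      have : 4 * (red cl').1 ≠ 0 := by have := (hred cl').1; omega
      exact mul_left_cancel₀ this (by linarith)
    have hr : red cl = red cl' := Prod.ext h.1 (Prod.ext h.2 h22)
    exact hmk _ _ ((hrel cl).trans (hr ▸ (hrel cl').symm))
  have : Finite (FormClass d) := by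
    have hfin : (Set.range φ).Finite := by
      refine ((Set.finite_Icc (0 : ℤ) d).prod (Set.finite_Icc (-d) d)).subset ?_
      rintro _ ⟨cl, rfl⟩
      have h0 := (hred cl).1
      have h1 : (red cl).1 ≤ d := by nlinarith [h3 cl]
      have h2 := abs_le.mp (hb cl)
      exact ⟨⟨h0.le, h1⟩, by simp only [φ]; omega, by simp only [φ]; omega⟩
    have := hfin.to_subtype
    exact .of_injective_finite_range hφ
  have := Fintype.ofFinite (FormClass d)
  set c₀ : FormClass d := Quot.mk _ ⟨principalForm d, hp⟩ with hc₀
  have hc₀rel : FormRel (Quot.out c₀).1 (principalForm d) :=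
    (formClass_mk_eq_iff (Quot.out c₀) ⟨principalForm d, hp⟩).mp (Quot.out_eq c₀)
  have ha2 (cl : FormClass d) (hcl : cl ≠ c₀) : 2 ≤ (red cl).1 := by
    by_contra hlt
    have h1 : (red cl).1 = 1 := by have := (hred cl).1; omega
    have := formRel_principalForm (hred cl) h1 (h1 ▸ hb cl)
    exact hcl (hmk _ _ (((hrel cl).trans this).trans hc₀rel.symm))
  obtain ⟨A, hA1, hA2⟩ : ∃ A : ℕ, 3 * (A : ℤ) ^ 2 ≤ d ∧ ∀ a : ℤ, 3 * a ^ 2 ≤ d → a ≤ A := by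
    obtain ⟨n, rfl⟩ := Int.eq_ofNat_of_zero_le hd.le
    refine ⟨Nat.sqrt (n / 3), ?_, fun a ha => ?_⟩
    · have := Nat.sqrt_le' (n / 3)
      have h2 : 3 * Nat.sqrt (n / 3) ^ 2 ≤ n := by omega
      exact_mod_cast h2
    · rcases le_or_gt a 0 with h | h
      · omega
      obtain ⟨m, rfl⟩ := Int.eq_ofNat_of_zero_le h.le
      have h4 : 3 * m ^ 2 ≤ n := by exact_mod_cast ha
      have h5 : m ≤ Nat.sqrt (n / 3) := Nat.le_sqrt'.mpr (by omega)
      exact_mod_cast h5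
  set B : Finset (ℤ × ℤ) := Finset.Icc 2 (A : ℤ) ×ˢ Finset.Icc (-(A : ℤ)) A with hB
  have hBcard : B.card = (A - 1) * (2 * A + 1) := by
    rw [hB, Finset.card_product, Int.card_Icc, Int.card_Icc]
    congr 1 <;> omega
  have hcard : (Finset.univ.erase c₀).card ≤ B.card := by
    refine Finset.card_le_card_of_injOn φ (fun cl hcl => ?_) hφ.injOn
    have hne := Finset.ne_of_mem_erase (Finset.mem_coe.mp hcl)
    have h1 := hA2 _ (h3 cl)
    have h2 := abs_le.mp (hb cl)
    simp only [hB, φ, Finset.coe_product, Set.mem_prod, Finset.mem_coe, Finset.mem_Icc]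
    exact ⟨⟨ha2 cl hne, h1⟩, by omega, by omega⟩
  refine ⟨B.card, ∑ cl ∈ Finset.univ.erase c₀, traceTerm (Quot.out cl).1, ?_, ?_, ?_, ?_⟩
  · rw [hBcard]
    rcases Nat.eq_zero_or_pos A with h | h
    · subst h; simp; omega
    · push_cast [Nat.cast_sub h]
      nlinarith
  · intro hlt
    have : A ≤ 1 := by
      by_contra hA
      have : (2 : ℤ) ≤ A := by omega
      nlinarith
    rw [hBcard, Nat.sub_eq_zero_of_le this, zero_mul]
  · refine (norm_sum_le_of_le (n := fun _ => Real.exp (Real.pi * √(d : ℝ) / 2) + 4131) _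
      (fun cl hcl => ?_)).trans ?_
    · rw [(hrel cl).traceTerm_eq hd (Quot.out cl).2 (hred cl)]
      exact norm_traceTerm_le (hred cl) (h3 cl) (ha2 cl (Finset.ne_of_mem_erase hcl))
    · rw [Finset.sum_const, nsmul_eq_mul]
      gcongr
  · rw [finsum_eq_sum_of_fintype, ← Finset.add_sum_erase _ _ (Finset.mem_univ c₀),
      hc₀rel.traceTerm_eq hd (Quot.out c₀).2 hp]

lemma traceSM_eq {d : ℤ} (hd : 0 < d) (hm : d % 4 = 0 ∨ d % 4 = 3) :
    traceSM d = (∑ᶠ cl : FormClass d, traceTerm (Quot.out cl).1).re := by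
  rw [traceSM, if_neg (by omega), if_neg (by omega), if_neg (by omega)]
  rfl

lemma fourteen_mul_le_exp {s : ℝ} (hs : 2 * √3 ≤ s) :
    14 * s ^ 2 ≤ Real.exp (Real.pi * s / 2) := by
  obtain ⟨δ, hδ, rfl⟩ : ∃ δ : ℝ, 0 ≤ δ ∧ s = 2 * √3 + δ := ⟨s - 2 * √3, by linarith, by ring⟩
  have hπ := Real.pi_gt_three
  have hsq : √3 ^ 2 = 3 := Real.sq_sqrt (by norm_num)
  have h3 : √3 ≤ 2 := Real.sqrt_le_iff.mpr (by norm_num)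
  have h30 := Real.sqrt_nonneg 3
  have h0 := exp_two_pi_mul_ge (le_refl (√3 / 2))
  have hw : 0 ≤ Real.pi * δ / 2 := by positivity
  have hq := Real.quadratic_le_exp_of_nonneg hw
  rw [show Real.pi * (2 * √3 + δ) / 2 = 2 * Real.pi * (√3 / 2) + Real.pi * δ / 2 by ring,
    Real.exp_add]
  have h1 : 3 * δ / 2 ≤ Real.pi * δ / 2 := by gcongr
  have h2 : 1 + 3 * δ / 2 + (3 * δ / 2) ^ 2 / 2 ≤ Real.exp (Real.pi * δ / 2) :=
    le_trans (by gcongr) hq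
  calc 14 * (2 * √3 + δ) ^ 2 ≤ 230 * (1 + 3 * δ / 2 + (3 * δ / 2) ^ 2 / 2) := by
        nlinarith [mul_le_mul_of_nonneg_right h3 hδ]
    _ ≤ _ := by gcongr

/-- The principal term dominates. -/
lemma error_lt_exp {d : ℤ} (hd : 7 ≤ d) {N : ℕ} (hN : 3 * (N : ℤ) ≤ 2 * d)
    (hN0 : d < 12 → N = 0) :
    950000 / Real.exp (Real.pi * √(d : ℝ)) +
      N * (Real.exp (Real.pi * √(d : ℝ) / 2) + 4131) < Real.exp (Real.pi * √(d : ℝ)) := by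
  have hX0 := Real.exp_pos (Real.pi * √(d : ℝ))
  rcases lt_or_ge d 12 with h | h
  · rw [hN0 h, Nat.cast_zero, zero_mul, add_zero, div_lt_iff₀ hX0]
    have h7 : (7 : ℝ) ≤ Real.pi * √(d : ℝ) := by
      have : (2.6 : ℝ) ≤ √(d : ℝ) := by
        refine Real.le_sqrt_of_sq_le ?_
        have : (7 : ℝ) ≤ d := by exact_mod_cast hd
        linarith
      nlinarith [Real.pi_gt_three]
    have h1 : (1000 : ℝ) ≤ Real.exp (Real.pi * √(d : ℝ)) := by
      refine le_trans ?_ (Real.exp_le_exp.mpr h7)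
      have h6 := Real.exp_one_gt_d9
      have h7 : (2.7182818283 : ℝ) ^ 7 ≤ Real.exp 1 ^ 7 := by gcongr
      rw [← Real.exp_nat_mul] at h7
      norm_num at h7 ⊢
      linarith
    nlinarith
  · have hdR : (12 : ℝ) ≤ d := by exact_mod_cast h
    have hs : 2 * √3 ≤ √(d : ℝ) := by
      refine Real.le_sqrt_of_sq_le ?_
      rw [mul_pow, Real.sq_sqrt (by norm_num)]
      linarith
    have h14 := fourteen_mul_le_exp hs
    rw [Real.sq_sqrt (by linarith)] at h14
    have h230 : 230 ≤ Real.exp (Real.pi * √(d : ℝ) / 2) := by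
      have := exp_two_pi_mul_ge (y := √(d : ℝ) / 4) (by linarith)
      rwa [show 2 * Real.pi * (√(d : ℝ) / 4) = Real.pi * √(d : ℝ) / 2 by ring] at this
    have hXx : Real.exp (Real.pi * √(d : ℝ)) = Real.exp (Real.pi * √(d : ℝ) / 2) ^ 2 := by
      rw [← Real.exp_nat_mul]; congr 1; push_cast; ring
    have hNR : 3 * (N : ℝ) ≤ 2 * d := by exact_mod_cast hN
    rw [hXx]
    set x := Real.exp (Real.pi * √(d : ℝ) / 2)
    have h1 : 950000 / x ^ 2 ≤ 18 := by
      rw [div_le_iff₀ (by positivity)]; nlinarith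
    have h2 : (N : ℝ) ≤ x / 21 := by linarith
    have h3 : N * (x + 4131) ≤ x / 21 * (x + 4131) := by gcongr
    nlinarith

lemma traceSM_four_pos : 0 < traceSM 4 := by
  obtain ⟨N, r, -, hN, hr, h⟩ := exists_finsum_eq (d := 4) (by norm_num) (by norm_num)
  rw [hN (by norm_num), Nat.cast_zero, zero_mul, norm_le_zero_iff] at hr
  rw [traceSM_eq (by norm_num) (by norm_num), h, hr, add_zero, traceTerm]
  have hroot : formRoot (principalForm 4) = I := by
    rw [(isForm_principalForm (d := 4) (by norm_num)).formRoot_eq]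
    have : √(4 : ℝ) = 2 := by
      rw [show (4 : ℝ) = 2 ^ 2 by norm_num]; exact Real.sqrt_sq (by norm_num)
    norm_num [principalForm, this]
  have hw : (0 : ℝ) < formWt (principalForm 4) := by
    exact_mod_cast formWt_principalForm_pos (Or.inr rfl)
  rw [hroot, jInv_I, div_natCast_re]
  norm_num
  exact_mod_cast hw

lemma traceSM_three_neg : traceSM 3 < 0 := by
  obtain ⟨N, r, -, hN, hr, h⟩ := exists_finsum_eq (d := 3) (by norm_num) (by norm_num)
  rw [hN (by norm_num), Nat.cast_zero, zero_mul, norm_le_zero_iff] at hr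
  rw [traceSM_eq (by norm_num) (by norm_num), h, hr, add_zero, traceTerm]
  have hroot := (isForm_principalForm (d := 3) (by norm_num)).formRoot_isRoot (by norm_num)
  have hj : jInv (formRoot (principalForm 3)) = 0 :=
    jInv_of_sq_add_self_add_one (by simpa [principalForm] using hroot)
  have hw : (0 : ℝ) < formWt (principalForm 3) := by
    exact_mod_cast formWt_principalForm_pos (Or.inl rfl)
  rw [hj, div_natCast_re]
  exact div_neg_of_neg_of_pos (by norm_num) hw

/-- For `d ≥ 7`, the trace has the sign `(-1) ^ d`. -/
lemma traceSM_mul_pos {d : ℤ} (hd : 7 ≤ d) (hm : d % 4 = 0 ∨ d % 4 = 3) :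
    0 < (-1) ^ (d % 2) * traceSM d := by
  obtain ⟨N, r, hN, hN0, hr, h⟩ := exists_finsum_eq (d := d) (by omega) hm
  have hp := norm_traceTerm_principalForm_sub_le (by omega) hm
  have hlt := error_lt_exp hd hN hN0
  rw [traceSM_eq (by omega) hm, h]
  set X := Real.exp (Real.pi * √(d : ℝ))
  have h1 := (Complex.abs_re_le_norm _).trans hp
  have h2 := (Complex.abs_re_le_norm _).trans hr
  rw [abs_le] at h1 h2
  rcases Int.emod_two_eq_zero_or_one d with h0 | h0 <;> rw [h0] at h1 ⊢ <;>
    simp at h1 ⊢ <;> linarith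

end Trace

/-- Sign of the trace of singular moduli: `t(d) > 0` if `d ≡ 0 (mod 4)` and
`t(d) < 0` if `d ≡ 3 (mod 4)`, for positive `d`. -/
theorem trace_sign (d : ℤ) (hd : 0 < d) :
    (d % 4 = 0 → 0 < traceSM d) ∧ (d % 4 = 3 → traceSM d < 0) := by
  constructor
  · intro hm
    rcases (by omega : d = 4 ∨ 7 ≤ d) with rfl | h7
    · exact traceSM_four_pos
    · have h := traceSM_mul_pos h7 (Or.inl hm)
      rw [show d % 2 = 0 by omega] at h
      simpa using h
  · intro hm
    rcases (by omega : d = 3 ∨ 7 ≤ d) with rfl | h7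
    · exact traceSM_three_neg
    · have h := traceSM_mul_pos h7 (Or.inr hm)
      rw [show d % 2 = 1 by omega] at h
      simpa using h
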